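/- arXiv:2207.05976 — 5 statements merged into one kernel-verified Lean document; each statement's English description precedes it below -/
import Mathlib

section
/- Let t and t₀ be positive integers with t₀ < t, and let x, y be integers with 0 ≤ x, y < 2^t. If d_t(x, y) < 2^{t − t₀}, then d_{t₀}(⌊x / 2^{t − t₀}⌋, ⌊y / 2^{t − t₀}⌋) ≤ 1. -/
/-- The circular distance on `t`-bit integers: `d_t(x,y) = min(|x-y|, 2^t - |x-y|)`. -/
def dt (t : ℕ) (x y : ℤ) : ℤ := min |x - y| ((2 : ℤ) ^ t - |x - y|)

/-- Let `t, t₀` be positive integers with `t₀ < t` and `x, y` integers with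
`0 ≤ x, y < 2^t`. If `d_t(x,y) < 2^(t - t₀)`, then
`d_{t₀}(⌊x / 2^(t - t₀)⌋, ⌊y / 2^(t - t₀)⌋) ≤ 1`. -/
theorem stmt_2 (t t₀ : ℕ) (ht₀ : 0 < t₀) (htt : t₀ < t) (x y : ℤ)
    (hx0 : 0 ≤ x) (hx1 : x < 2 ^ t) (hy0 : 0 ≤ y) (hy1 : y < 2 ^ t)
    (hd : dt t x y < 2 ^ (t - t₀)) :
    dt t₀ (x / 2 ^ (t - t₀)) (y / 2 ^ (t - t₀)) ≤ 1 := by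
  obtain ⟨M, hM⟩ : ∃ M : ℤ, M = 2 ^ (t - t₀) := ⟨_, rfl⟩
  obtain ⟨N, hN⟩ : ∃ N : ℤ, N = 2 ^ t₀ := ⟨_, rfl⟩
  have hNM : (2 : ℤ) ^ t = N * M := by
    rw [hM, hN, ← pow_add, Nat.add_sub_cancel' htt.le]
  have hMpos : 0 < M := hM ▸ by positivity
  unfold dt at hd ⊢
  rw [← hM, hNM] at hd
  rw [← hM, ← hN]
  have hxl := Int.mul_ediv_self_le (x := x) hMpos.ne'
  have hxu := Int.lt_mul_ediv_self_add (x := x) hMpos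
  have hyl := Int.mul_ediv_self_le (x := y) hMpos.ne'
  have hyu := Int.lt_mul_ediv_self_add (x := y) hMpos
  generalize x / M = a at *
  generalize y / M = b at *
  rcases min_lt_iff.mp hd with h | h
  · refine min_le_of_left_le (abs_le.mpr ?_)
    obtain ⟨h₁, h₂⟩ := abs_lt.mp h
    have hab : a < b + 2 := lt_of_mul_lt_mul_left (by linarith) hMpos.le
    have hba : b < a + 2 := lt_of_mul_lt_mul_left (by linarith) hMpos.le
    constructor <;> linarith
  · refine min_le_of_right_le ?_
    rcases lt_abs.mp (sub_lt_comm.mp h) with h | h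
    · have hab : N < a - b + 2 := lt_of_mul_lt_mul_left (by linarith) hMpos.le
      linarith [le_abs_self (a - b)]
    · have hba : N < b - a + 2 := lt_of_mul_lt_mul_left (by linarith) hMpos.le
      linarith [neg_le_abs (a - b)]
end

section
/- Let L be an even positive integer, let p be a positive integer, and set t₂ = 3L/2 + 2 + p. Let r and s₀ be integers with 0 ≤ s₀ < r < 2^L such that 2^{L/2 + 1} · s₀ / r is not an integer. Let m₂ be an integer with 0 ≤ m₂ < 2^{t₂} satisfying d_{t₂}(m₂, FBits(s₀/r, L/2, 2L + 1 + p)) < 2^p. Then IBits(m₂, 1, 2) = FBits(s₀/r, L/2, L/2 + 1), i.e., ⌊m₂ / 2^{t₂ − 2}⌋ = ⌊2^{L/2 + 1} s₀ / r⌋ mod 4. -/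
theorem floor_intCast_div_intCast (a : ℤ) {r : ℤ} (hr : 0 < r) :
    ⌊(a : ℝ) / (r : ℝ)⌋ = a / r := by
  have hr' : (0 : ℝ) < r := by exact_mod_cast hr
  rw [Int.floor_eq_iff, le_div_iff₀ hr', div_lt_iff₀ hr']
  exact ⟨by exact_mod_cast Int.ediv_mul_le a hr.ne',
    by exact_mod_cast Int.lt_ediv_add_one_mul_self a hr⟩

/-- If the remainder of `A` modulo `r` is nonzero, then scaling `A` by `T > r * q` puts the
quotient by `r` at distance at least `q` from the multiples of `T` around it. -/
theorem exists_mul_ediv_eq {A r T q : ℤ} (hr : 0 < r) (hq : 0 < q) (hT : r * q < T)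
    (hA : A % r ≠ 0) :
    ∃ f, T * A / r = T * (A / r) + f ∧ q ≤ f ∧ f < T - q := by
  have hR0 : 1 ≤ A % r := by have := Int.emod_nonneg A hr.ne'; omega
  have hR1 : A % r ≤ r - 1 := by have := Int.emod_lt_of_pos A hr; omega
  have hT0 : 0 < T := (mul_pos hr hq).trans hT
  refine ⟨T * (A % r) / r, ?_, ?_, ?_⟩
  · have h : T * A = T * (A % r) + T * (A / r) * r := by
      conv_lhs => rw [← Int.emod_add_mul_ediv A r]
      ring
    rw [h, Int.add_mul_ediv_right _ _ hr.ne', add_comm]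
  · rw [Int.le_ediv_iff_mul_le hr]
    nlinarith
  · rw [Int.ediv_lt_iff_lt_mul hr]
    nlinarith

/-- A circular perturbation of size less than `q` does not change the top two bits of
`T * b + f` when `f` is at distance at least `q` from `0` and `T`. -/
theorem ediv_eq_of_min_abs_sub_lt {T q b f m : ℤ} (hT : 0 < T) (hb0 : 0 ≤ b) (hb4 : b < 4)
    (hf0 : q ≤ f) (hf1 : f < T - q) (hm0 : 0 ≤ m) (hm1 : m < 4 * T)
    (hd : min |m - (T * b + f)| (4 * T - |m - (T * b + f)|) < q) : m / T = b := by
  rw [Int.ediv_eq_iff_of_pos hT]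
  have h0 : 0 ≤ T * b := by positivity
  have h3 : T * b ≤ T * 3 := by gcongr; omega
  rw [mul_comm b T]
  rcases min_lt_iff.mp hd with h | h
  · rw [abs_lt] at h
    constructor <;> linarith [h.1, h.2]
  · exfalso
    have : |m - (T * b + f)| ≤ 4 * T - q := abs_le.mpr ⟨by linarith, by linarith⟩
    linarith

/-- Let `L` be an even positive integer, `p` a positive integer, `t₂ = 3L/2 + 2 + p`.
Let `0 ≤ s₀ < r < 2^L` with `2^(L/2+1)·s₀/r` not an integer. If `m₂` is a `t₂`-bit
integer with `d_{t₂}(m₂, FBits(s₀/r, L/2, 2L+1+p)) < 2^p`, then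
`⌊m₂ / 2^(t₂-2)⌋ = ⌊2^(L/2+1) s₀ / r⌋ mod 4`. -/
theorem stmt_6 (L p : ℕ) (hL : 0 < L) (hLeven : Even L) (hp : 0 < p)
    (t₂ : ℕ) (ht₂ : t₂ = 3 * (L / 2) + 2 + p)
    (r s₀ : ℤ) (hs₀ : 0 ≤ s₀) (hsr : s₀ < r) (hr : r < 2 ^ L)
    (hni : ¬ ∃ z : ℤ, (2 : ℝ) ^ (L / 2 + 1) * (s₀ : ℝ) / (r : ℝ) = (z : ℝ))
    (m₂ : ℤ) (hm₂0 : 0 ≤ m₂) (hm₂1 : m₂ < 2 ^ t₂)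
    (hd : dt t₂ m₂ (⌊(2 : ℝ) ^ (2 * L + 1 + p) * (s₀ : ℝ) / (r : ℝ)⌋ % 2 ^ t₂) < 2 ^ p) :
    m₂ / 2 ^ (t₂ - 2) = ⌊(2 : ℝ) ^ (L / 2 + 1) * (s₀ : ℝ) / (r : ℝ)⌋ % 4 := by
  obtain ⟨k, rfl⟩ := hLeven
  have hk : (k + k) / 2 = k := by omega
  rw [hk] at hni ht₂ ⊢
  have hr0 : 0 < r := hs₀.trans_lt hsr
  have hr0' : (r : ℝ) ≠ 0 := by exact_mod_cast hr0.ne'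
  set A : ℤ := 2 ^ (k + 1) * s₀ with hA
  set T : ℤ := 2 ^ (t₂ - 2) with hT
  have hfloor : ⌊(2 : ℝ) ^ (k + 1) * (s₀ : ℝ) / (r : ℝ)⌋ = A / r := by
    rw [← floor_intCast_div_intCast A hr0, hA]
    push_cast
    rfl
  have hpow : (2 : ℤ) ^ (2 * (k + k) + 1 + p) * s₀ = T * A := by
    rw [hT, hA, ← mul_assoc, ← pow_add]
    congr 2
    omega
  have hfloor' : ⌊(2 : ℝ) ^ (2 * (k + k) + 1 + p) * (s₀ : ℝ) / (r : ℝ)⌋ = T * A / r := by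
    rw [← floor_intCast_div_intCast (T * A) hr0, ← hpow]
    push_cast
    rfl
  have hT0 : 0 < T := by positivity
  have hT4 : (2 : ℤ) ^ t₂ = 4 * T := by
    rw [hT, show t₂ = t₂ - 2 + 2 by omega, pow_add]
    simp [mul_comm]
  have hrem : A % r ≠ 0 := by
    intro h
    obtain ⟨z, hz⟩ := Int.dvd_of_emod_eq_zero h
    refine hni ⟨z, ?_⟩
    rw [div_eq_iff hr0', mul_comm (z : ℝ)]
    exact_mod_cast hz
  have hrT : r * 2 ^ p < T := by
    calc r * 2 ^ p < 2 ^ (k + k) * 2 ^ p := by gcongr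
      _ = 2 ^ (k + k + p) := (pow_add _ _ _).symm
      _ ≤ T := pow_le_pow_right₀ (by norm_num) (by omega)
  obtain ⟨f, hf, hf0, hf1⟩ := exists_mul_ediv_eq hr0 (by positivity) hrT hrem
  have hq : (0 : ℤ) < 2 ^ p := by positivity
  have hb0 : 0 ≤ A / r % 4 := Int.emod_nonneg _ (by norm_num)
  have hb4 : A / r % 4 < 4 := Int.emod_lt_of_pos _ (by norm_num)
  have hmod : T * A / r % (4 * T) = T * (A / r % 4) + f := by
    have h : T * (A / r) + f = T * (A / r % 4) + f + 4 * T * (A / r / 4) := by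
      conv_lhs => rw [← Int.emod_add_mul_ediv (A / r) 4]
      ring
    rw [hf, h, Int.add_mul_emod_self_left]
    apply Int.emod_eq_of_lt
    · nlinarith
    · nlinarith
  rw [hfloor]
  rw [hfloor', hT4, hmod, dt, hT4] at hd
  exact ediv_eq_of_min_abs_sub_lt hT0 hb0 hb4 hf0 hf1 hm₂0 (hT4 ▸ hm₂1) hd
end

section
/- Let t > 2 be a positive integer and let x, y be integers with 0 ≤ x, y < 2^t such that d_t(x, y) ≤ 1. Then for any b ∈ {−1, 0, 1}, (x + b) mod 2^t = y if and only if ((x mod 4) + b) mod 4 = y mod 4 (i.e., the addition of b matches on the last two bits of x and y). -/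
/-- Let `t > 2` be a positive integer and `x, y` integers with `0 ≤ x, y < 2^t` such
that `d_t(x,y) ≤ 1`. Then for any `b ∈ {-1, 0, 1}`, `(x + b) mod 2^t = y` iff
`((x mod 4) + b) mod 4 = y mod 4`. -/
theorem stmt_8 (t : ℕ) (ht : 2 < t) (x y : ℤ)
    (hx0 : 0 ≤ x) (hx1 : x < 2 ^ t) (hy0 : 0 ≤ y) (hy1 : y < 2 ^ t)
    (hd : dt t x y ≤ 1) :
    ∀ b ∈ ({-1, 0, 1} : Set ℤ),
      ((x + b) % 2 ^ t = y ↔ (x % 4 + b) % 4 = y % 4) := by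
  intro b hb
  obtain ⟨k, hk, hM⟩ : ∃ k : ℤ, 2 ≤ k ∧ (2 : ℤ) ^ t = 4 * k := by
    obtain ⟨s, rfl⟩ := Nat.exists_eq_add_of_lt ht
    refine ⟨2 * 2 ^ s, ?_, by ring⟩
    have : (0 : ℤ) < 2 ^ s := by positivity
    omega
  unfold dt at hd
  rw [hM] at hx1 hy1 hd ⊢
  have hb' : b = -1 ∨ b = 0 ∨ b = 1 := by simpa using hb
  have hd' : (-1 ≤ x - y ∧ x - y ≤ 1) ∨ 4 * k - 1 ≤ x - y ∨ x - y ≤ 1 - 4 * k := by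
    rcases min_le_iff.mp hd with h | h
    · exact Or.inl (abs_le.mp h)
    · rcases le_abs.mp (show 4 * k - 1 ≤ |x - y| by omega) with h | h <;> omega
  have hmod : (x + b) % (4 * k) = y ↔ x + b = y ∨ x + b = y + 4 * k ∨ x + b = y - 4 * k := by
    constructor
    · intro h
      by_cases h0 : x + b < 0
      · rw [← Int.add_emod_right, Int.emod_eq_of_lt (by omega) (by omega)] at h
        omega
      · by_cases h1 : x + b < 4 * k
        · rw [Int.emod_eq_of_lt (by omega) h1] at h
          exact Or.inl h
        · rw [← Int.sub_emod_right, Int.emod_eq_of_lt (by omega) (by omega)] at h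
          omega
    · rintro (h | h | h) <;> rw [h]
      · exact Int.emod_eq_of_lt hy0 hy1
      · rw [Int.add_emod_right, Int.emod_eq_of_lt hy0 hy1]
      · rw [Int.sub_emod_right, Int.emod_eq_of_lt hy0 hy1]
  rw [hmod]
  omega
end

section
/- Let t and n be positive integers with n < t, and let x, y be integers with 0 ≤ x, y < 2^t. Suppose ⌊y / 2^{t − n}⌋ is neither 0 nor 2^n − 1 (i.e., the first n bits of y are neither all zeros nor all ones), and suppose d_t(x, y) < 2^{t − n}. Then d_t(x, y) = |x − y|. -/
/-- Let `t, n` be positive integers with `n < t`, and `x, y` integers with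
`0 ≤ x, y < 2^t`. Suppose `⌊y / 2^(t-n)⌋` is neither `0` nor `2^n - 1`, and suppose
`d_t(x,y) < 2^(t-n)`. Then `d_t(x,y) = |x - y|`. -/
theorem stmt_9 (t n : ℕ) (hn : 0 < n) (hnt : n < t) (x y : ℤ)
    (hx0 : 0 ≤ x) (hx1 : x < 2 ^ t) (hy0 : 0 ≤ y) (hy1 : y < 2 ^ t)
    (hy2 : y / 2 ^ (t - n) ≠ 0) (hy3 : y / 2 ^ (t - n) ≠ 2 ^ n - 1)
    (hd : dt t x y < 2 ^ (t - n)) :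
    dt t x y = |x - y| := by
  have hM : (0 : ℤ) < 2 ^ (t - n) := by positivity
  have hpow : (2 : ℤ) ^ t = 2 ^ n * 2 ^ (t - n) := by
    rw [← pow_add, Nat.add_sub_cancel' hnt.le]
  have hlow : (2 : ℤ) ^ (t - n) ≤ y := by
    by_contra! h
    exact hy2 (Int.ediv_eq_zero_of_lt hy0 h)
  have hhigh : y < 2 ^ t - 2 ^ (t - n) := by
    have hlt : y / 2 ^ (t - n) < 2 ^ n := Int.ediv_lt_of_lt_mul hM (hpow ▸ hy1)
    have hlt' : y / 2 ^ (t - n) < 2 ^ n - 1 := by omega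
    have := Int.lt_mul_of_ediv_lt hM hlt'
    rw [hpow]
    linarith
  have habs : |x - y| < 2 ^ t - 2 ^ (t - n) :=
    abs_lt.mpr ⟨by linarith, by linarith⟩
  unfold dt at hd ⊢
  rcases min_lt_iff.mp hd with h | h
  · refine min_eq_left ?_
    have htwo : (2 : ℤ) ≤ 2 ^ n := by
      simpa using pow_le_pow_right₀ (one_le_two : (1 : ℤ) ≤ 2) hn
    nlinarith
  · linarith
end

section
/- Let L be an even positive integer, let p be a positive integer, and set t₁ = L/2 + 1 + p and t₂ = 3L/2 + 2 + p. Let r and s₀ be integers with 0 ≤ s₀ < r < 2^L such that 2^{L/2 + 1} · s₀ / r is not an integer. Let m₁ be an integer with 0 ≤ m₁ < 2^{t₁} satisfying d_{t₁}(m₁, FBits(s₀/r, 1, t₁)) < 2^p, and let m₂ be an integer with 0 ≤ m₂ < 2^{t₂} satisfying d_{t₂}(m₂, FBits(s₀/r, L/2, 2L + 1 + p)) < 2^p. Then there exists b ∈ {−1, 0, 1} with ((⌊m₁ / 2^p⌋ mod 4) + b) mod 4 = ⌊m₂ / 2^{t₂ − 2}⌋, and for any such b, the integer m = ((⌊m₁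 / 2^p⌋ + b) mod 2^{L/2 + 1}) · 2^{t₂ − 2} + (m₂ mod 2^{t₂ − 2}) satisfies |m / 2^{2L + 1 + p} − s₀ / r| ≤ 2^{−(2L + 1)}. -/
theorem exists_add_mul_of_dt_lt {t : ℕ} {x y D : ℤ} (hx : 0 ≤ x) (hx' : x < 2 ^ t)
    (hy : 0 ≤ y) (hy' : y < 2 ^ t) (h : dt t x y < D) :
    ∃ e c : ℤ, x = y + e + c * 2 ^ t ∧ -D < e ∧ e < D := by
  unfold dt at h
  rcases min_lt_iff.1 h with h | h
  · exact ⟨x - y, 0, by ring, (abs_lt.1 h).1, (abs_lt.1 h).2⟩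
  · rcases abs_cases (x - y) with ⟨h1, h2⟩ | ⟨h1, h2⟩
    · exact ⟨x - y - 2 ^ t, 1, by ring, by linarith, by linarith⟩
    · exact ⟨x - y + 2 ^ t, -1, by ring, by linarith, by linarith⟩

theorem floor_div_mul_bounds (n : ℤ) {r : ℤ} (hr : 0 < r) :
    ⌊(n : ℝ) / r⌋ * r ≤ n ∧ n < (⌊(n : ℝ) / r⌋ + 1) * r := by
  have hr' : (0 : ℝ) < r := by exact_mod_cast hr
  have h1 := Int.floor_le ((n : ℝ) / r)
  have h2 := Int.lt_floor_add_one ((n : ℝ) / r)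
  rw [le_div_iff₀ hr'] at h1
  rw [div_lt_iff₀ hr'] at h2
  exact ⟨by exact_mod_cast h1, by exact_mod_cast h2⟩

/-- If `m₁` approximates `F`, whose high part is `a`, and `m₂` approximates `A`, which is far from
the boundaries of its block `[a * Q, (a + 1) * Q)`, then the correction bit exists and any such bit
recovers the high part `a` exactly. -/
theorem correction_bit {P K Q a F A m₁ m₂ e₁ e₂ c₁ c₂ : ℤ} (hP : 0 < P) (hQ : 0 < Q)
    (hK : 4 ∣ K) (ha : 0 ≤ a) (haK : a < K) (hF : a * P ≤ F) (hF' : F < (a + 1) * P)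
    (hA : a * Q + P ≤ A) (hA' : A + P ≤ (a + 1) * Q)
    (hm₁ : m₁ = F + e₁ + c₁ * (K * P)) (he₁ : -P < e₁) (he₁' : e₁ < P)
    (hm₂0 : 0 ≤ m₂) (hm₂1 : m₂ < 4 * Q)
    (hm₂ : m₂ = A % (4 * Q) + e₂ + c₂ * (4 * Q)) (he₂ : -P < e₂) (he₂' : e₂ < P) :
    (∃ b ∈ ({-1, 0, 1} : Set ℤ), (m₁ / P % 4 + b) % 4 = m₂ / Q) ∧
    ∀ b ∈ ({-1, 0, 1} : Set ℤ), (m₁ / P % 4 + b) % 4 = m₂ / Q →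
      ((m₁ / P + b) % K) * Q + m₂ % Q = A + e₂ := by
  obtain ⟨K', rfl⟩ := hK
  have hA4 := Int.emod_add_mul_ediv A (4 * Q)
  set q := A / (4 * Q)
  have hm₂' : m₂ = (A + e₂ - a * Q) + (a + 4 * (c₂ - q)) * Q := by linarith
  have hdiv : m₂ / Q = a + 4 * (c₂ - q) := by
    rw [hm₂', Int.add_mul_ediv_right _ _ hQ.ne',
      Int.ediv_eq_zero_of_lt (by linarith) (by linarith), zero_add]
  have hmod : m₂ % Q = A + e₂ - a * Q := by
    rw [hm₂', Int.add_mul_emod_self_right, Int.emod_eq_of_lt (by linarith) (by linarith)]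
  have hdiv4 : m₂ / Q < 4 := Int.ediv_lt_of_lt_mul hQ hm₂1
  have hdiv0 : 0 ≤ m₂ / Q := Int.ediv_nonneg hm₂0 hQ.le
  obtain ⟨δ, hδ, hδ', hdiv₁⟩ : ∃ δ : ℤ, -1 ≤ δ ∧ δ ≤ 1 ∧ m₁ / P = a + δ + 4 * (c₁ * K') := by
    refine ⟨(F + e₁) / P - a, ?_, ?_, ?_⟩
    · have : a - 1 ≤ (F + e₁) / P := (Int.le_ediv_iff_mul_le hP).2 (by linarith)
      linarith
    · have : (F + e₁) / P < a + 2 := Int.ediv_lt_of_lt_mul hP (by linarith)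
      linarith
    · rw [hm₁, show c₁ * (4 * K' * P) = (4 * (c₁ * K')) * P by ring,
        Int.add_mul_ediv_right _ _ hP.ne']
      ring
  constructor
  · refine ⟨-δ, ?_, by omega⟩
    simp only [Set.mem_insert_iff, Set.mem_singleton_iff]
    omega
  · intro b hb h
    simp only [Set.mem_insert_iff, Set.mem_singleton_iff] at hb
    obtain rfl : b = -δ := by omega
    rw [hmod, hdiv₁, show a + δ + 4 * (c₁ * K') + -δ = a + c₁ * (4 * K') by ring,
      Int.add_mul_emod_self_right, Int.emod_eq_of_lt ha haK]
    ring

/-- Correctness of the `CorrectResults` subroutine: given `t₁`-bit `m₁` estimating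
`FBits(s₀/r, 1, t₁)` and `t₂`-bit `m₂` estimating `FBits(s₀/r, L/2, 2L+1+p)` (each
within circular distance `2^p`), with `2^(L/2+1)·s₀/r` not an integer, a correction
bit `b ∈ {-1,0,1}` exists, and any such `b` yields a combined `(2L+1+p)`-bit result
`m` with `|m / 2^(2L+1+p) - s₀/r| ≤ 2^(-(2L+1))`. -/
theorem stmt_11 (L p : ℕ) (hL : 0 < L) (hLeven : Even L) (hp : 0 < p)
    (t₁ t₂ : ℕ) (ht₁ : t₁ = L / 2 + 1 + p) (ht₂ : t₂ = 3 * (L / 2) + 2 + p)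
    (r s₀ : ℤ) (hs₀ : 0 ≤ s₀) (hsr : s₀ < r) (hr : r < 2 ^ L)
    (hni : ¬ ∃ z : ℤ, (2 : ℝ) ^ (L / 2 + 1) * (s₀ : ℝ) / (r : ℝ) = (z : ℝ))
    (m₁ : ℤ) (hm₁0 : 0 ≤ m₁) (hm₁1 : m₁ < 2 ^ t₁)
    (hd₁ : dt t₁ m₁ ⌊(2 : ℝ) ^ t₁ * (s₀ : ℝ) / (r : ℝ)⌋ < 2 ^ p)
    (m₂ : ℤ) (hm₂0 : 0 ≤ m₂) (hm₂1 : m₂ < 2 ^ t₂)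
    (hd₂ : dt t₂ m₂ (⌊(2 : ℝ) ^ (2 * L + 1 + p) * (s₀ : ℝ) / (r : ℝ)⌋ % 2 ^ t₂) < 2 ^ p) :
    (∃ b ∈ ({-1, 0, 1} : Set ℤ),
        (m₁ / 2 ^ p % 4 + b) % 4 = m₂ / 2 ^ (t₂ - 2)) ∧
    ∀ b ∈ ({-1, 0, 1} : Set ℤ),
      (m₁ / 2 ^ p % 4 + b) % 4 = m₂ / 2 ^ (t₂ - 2) →
      |((((m₁ / 2 ^ p + b) % 2 ^ (L / 2 + 1)) * 2 ^ (t₂ - 2) + m₂ % 2 ^ (t₂ - 2) : ℤ) : ℝ)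
          / 2 ^ (2 * L + 1 + p) - (s₀ : ℝ) / (r : ℝ)|
        ≤ 1 / 2 ^ (2 * L + 1) := by
  obtain ⟨k, rfl⟩ := hLeven
  have hk : 0 < k := by omega
  rw [show (k + k) / 2 = k by omega] at *
  have hr0 : 0 < r := by linarith
  have hrR : (0 : ℝ) < r := by exact_mod_cast hr0
  set P : ℤ := 2 ^ p with hP
  set K : ℤ := 2 ^ (k + 1) with hK
  set R : ℤ := 2 ^ (3 * k) with hR
  have hP0 : 0 < P := by positivity
  have hK0 : 0 < K := by positivity
  have hR0 : 0 < R := by positivity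
  have hQ : (2 : ℤ) ^ (t₂ - 2) = R * P := by
    rw [hR, hP, ← pow_add]; congr 1; omega
  have h4Q : (2 : ℤ) ^ t₂ = 4 * (R * P) := by
    rw [← hQ, show (4 : ℤ) = 2 ^ 2 by norm_num, ← pow_add]; congr 1; omega
  have hKP : (2 : ℤ) ^ t₁ = K * P := by
    rw [hK, hP, ← pow_add, ht₁]
  have hN : (2 : ℤ) ^ (2 * (k + k) + 1 + p) = K * (R * P) := by
    rw [hK, hR, hP, ← pow_add, ← pow_add]; congr 1; omega
  have hK4 : 4 ∣ K := by
    rw [hK, show (4 : ℤ) = 2 ^ 2 by norm_num]; exact pow_dvd_pow _ (by omega)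
  have hrR' : r ≤ R := hr.le.trans (pow_le_pow_right₀ (by norm_num) (by omega))
  have hcast₁ : (2 : ℝ) ^ t₁ * s₀ / r = ((K * P * s₀ : ℤ) : ℝ) / r := by
    rw [← hKP]; push_cast; rfl
  have hcast₂ : (2 : ℝ) ^ (2 * (k + k) + 1 + p) * s₀ / r = ((K * (R * P) * s₀ : ℤ) : ℝ) / r := by
    rw [← hN]; push_cast; rfl
  rw [hcast₁] at hd₁
  rw [hcast₂] at hd₂
  obtain ⟨hF, hF'⟩ := floor_div_mul_bounds (K * P * s₀) hr0
  obtain ⟨hA, hA'⟩ := floor_div_mul_bounds (K * (R * P) * s₀) hr0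
  obtain ⟨ha, ha'⟩ := floor_div_mul_bounds (K * s₀) hr0
  set F : ℤ := ⌊((K * P * s₀ : ℤ) : ℝ) / r⌋
  set A : ℤ := ⌊((K * (R * P) * s₀ : ℤ) : ℝ) / r⌋
  set a : ℤ := ⌊((K * s₀ : ℤ) : ℝ) / r⌋
  have ha1 : a * r + 1 ≤ K * s₀ := by
    rcases ha.lt_or_eq with h | h
    · exact h
    · refine absurd ⟨a, ?_⟩ hni
      rw [div_eq_iff hrR.ne']
      have h' : ((a * r : ℤ) : ℝ) = ((K * s₀ : ℤ) : ℝ) := by rw [h]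
      rw [hK] at h'
      push_cast at h'
      exact h'.symm
  have ha0 : 0 ≤ a := by
    have : 0 < (a + 1) * r := lt_of_le_of_lt (by positivity) ha'
    have := pos_of_mul_pos_left this hr0.le
    omega
  have haK : a < K := by
    refine lt_of_mul_lt_mul_right (lt_of_le_of_lt ha ?_) hr0.le
    exact mul_lt_mul_of_pos_left hsr hK0
  have hFa : a * P ≤ F := by
    have : a * P * r < (F + 1) * r := by nlinarith
    have := lt_of_mul_lt_mul_right this hr0.le
    omega
  have hFa' : F < (a + 1) * P := by
    refine lt_of_mul_lt_mul_right (lt_of_le_of_lt hF ?_) hr0.le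
    nlinarith
  have hrP : P * r ≤ R * P := by nlinarith
  have hQ0 : 0 < R * P := by positivity
  have hAa : a * (R * P) + P ≤ A := by
    have : (a * (R * P) + P) * r < (A + 1) * r := by
      have := mul_le_mul_of_nonneg_left ha1 hQ0.le
      linarith
    have := lt_of_mul_lt_mul_right this hr0.le
    omega
  have hAa' : A + P ≤ (a + 1) * (R * P) := by
    refine le_of_mul_le_mul_right ?_ hr0
    have := mul_le_mul_of_nonneg_left (Int.add_one_le_of_lt ha') hQ0.le
    linarith
  have hF0 : 0 ≤ F := le_trans (by positivity) hFa
  have hFlt : F < 2 ^ t₁ := by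
    rw [hKP]
    exact hFa'.trans_le (mul_le_mul_of_nonneg_right (by omega) hP0.le)
  obtain ⟨e₁, c₁, hm₁, he₁, he₁'⟩ := exists_add_mul_of_dt_lt hm₁0 hm₁1 hF0 hFlt hd₁
  obtain ⟨e₂, c₂, hm₂, he₂, he₂'⟩ := exists_add_mul_of_dt_lt hm₂0 hm₂1
    (Int.emod_nonneg _ (by positivity)) (Int.emod_lt_of_pos _ (by positivity)) hd₂
  rw [hKP] at hm₁
  rw [h4Q] at hm₂ hm₂1
  rw [hQ]
  obtain ⟨hex, hall⟩ := correction_bit hP0 hQ0 hK4 ha0 haK hFa hFa' hAa hAa' hm₁ he₁ he₁'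
    hm₂0 hm₂1 hm₂ he₂ he₂'
  refine ⟨hex, fun b hb h => ?_⟩
  rw [hall b hb h]
  have hlow : -(P * r) ≤ (A + e₂) * r - K * (R * P) * s₀ := by
    have := mul_le_mul_of_nonneg_right (show 1 ≤ e₂ + P by omega) hr0.le
    linarith
  have hupp : (A + e₂) * r - K * (R * P) * s₀ ≤ P * r := by
    have := mul_le_mul_of_nonneg_right he₂'.le hr0.le
    linarith
  rw [← hN] at hlow hupp
  have hlow' : -((2 : ℝ) ^ p * r) ≤ (A + e₂) * r - 2 ^ (2 * (k + k) + 1 + p) * s₀ := by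
    exact_mod_cast hlow
  have hupp' : (A + e₂) * r - 2 ^ (2 * (k + k) + 1 + p) * s₀ ≤ (2 : ℝ) ^ p * r := by
    exact_mod_cast hupp
  have hN0 : (0 : ℝ) < 2 ^ (2 * (k + k) + 1 + p) := by positivity
  rw [div_sub_div _ _ hN0.ne' hrR.ne', abs_div, abs_of_pos (mul_pos hN0 hrR),
    div_le_iff₀ (mul_pos hN0 hrR)]
  have hpow : 1 / (2 : ℝ) ^ (2 * (k + k) + 1) * (2 ^ (2 * (k + k) + 1 + p) * r) = 2 ^ p * r := by
    rw [pow_add _ (2 * (k + k) + 1) p]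
    field_simp
  rw [hpow, abs_le]
  push_cast
  exact ⟨hlow', hupp'⟩
end
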